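/- For every constrained state s of the UMO component U_i of address i, there exists a unique constrained trace of U_i (starting in the initial state ⟨[], i⟩) that reaches s. -/

import Mathlib

set_option autoImplicit false

universe u v w

/-- A validating labelled state transition and message production system (VLSM):
labels, a nonempty set of initial states, initial messages, a total transition
function and a validity constraint.  `Option M` plays the role of `M ∪ {⊥}`. -/
structure VLSM (L : Type u) (S : Type v) (M : Type w) where
  init : Set S
  init_ne : init.Nonempty
  initMsg : Set M
  tau : L → S → Option M → S × Option M
  beta : L → S → Option M → Prop

/-- A transition record: label, source state, input message, target state, output message. -/
structure VTrans (L : Type u) (S : Type v) (M : Type w) where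
  lbl : L
  src : S
  msg : Option M
  dst : S
  out : Option M

variable {L : Type u} {S : Type v} {M : Type w}

/-- `Chain s tr sf`: the transitions of `tr` link up, starting at `s` and ending at `sf`. -/
def Chain : S → List (VTrans L S M) → S → Prop
  | s, [], sf => s = sf
  | s, t :: ts, sf => t.src = s ∧ Chain t.dst ts sf

namespace VLSM

/-- `t` is an actual transition of `V` (the transition function agrees with `t`). -/
def IsTrans (V : VLSM L S M) (t : VTrans L S M) : Prop :=
  V.tau t.lbl t.src t.msg = (t.dst, t.out)

/-- `t` is a constrained transition of `V`. -/
def IsConstrainedTrans (V : VLSM L S M) (t : VTrans L S M) : Prop :=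
  V.IsTrans t ∧ V.beta t.lbl t.src t.msg

/-- `tr` is a constrained trace of `V` reaching the state `sf`. -/
def ConstrainedTraceTo (V : VLSM L S M) (tr : List (VTrans L S M)) (sf : S) : Prop :=
  (∀ t ∈ tr, V.IsConstrainedTrans t) ∧ ∃ s0 ∈ V.init, Chain s0 tr sf

/-- A state is constrained if some constrained trace reaches it. -/
def ConstrainedState (V : VLSM L S M) (s : S) : Prop :=
  ∃ tr, V.ConstrainedTraceTo tr s

/-- Constrained reachability, defined inductively (a state is constrained iff it is
reachable from an initial state by constrained transitions). -/
inductive ReachState (V : VLSM L S M) : S → Prop where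
  | init {s} : s ∈ V.init → ReachState V s
  | step {l s m} : ReachState V s → V.beta l s m → ReachState V (V.tau l s m).1

mutual
  /-- Valid states of a VLSM. -/
  inductive ValidState (V : VLSM L S M) : S → Prop where
    | init {s} : s ∈ V.init → ValidState V s
    | step {l s m} : ValidState V s → ValidOMsg V m → V.beta l s m →
        ValidState V (V.tau l s m).1
  /-- Valid optional messages of a VLSM (`none` is always valid). -/
  inductive ValidOMsg (V : VLSM L S M) : Option M → Prop where
    | none : ValidOMsg V Option.none
    | init {m} : m ∈ V.initMsg → ValidOMsg V (some m)
    | step {l s m} : ValidState V s → ValidOMsg V m → V.beta l s m →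
        ValidOMsg V (V.tau l s m).2
end

/-- `t` is a valid transition of `V`. -/
def IsValidTrans (V : VLSM L S M) (t : VTrans L S M) : Prop :=
  V.IsConstrainedTrans t ∧ V.ValidState t.src ∧ V.ValidOMsg t.msg

/-- `tr` is a valid trace of `V` reaching the state `sf`. -/
def ValidTraceTo (V : VLSM L S M) (tr : List (VTrans L S M)) (sf : S) : Prop :=
  (∀ t ∈ tr, V.IsValidTrans t) ∧ ∃ s0 ∈ V.init, Chain s0 tr sf

/-- `tr` is a valid trace of `V`. -/
def IsValidTrace (V : VLSM L S M) (tr : List (VTrans L S M)) : Prop :=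
  ∃ sf, V.ValidTraceTo tr sf

end VLSM

/-- The message `m` is emitted (sent) on the trace `tr`. -/
def EmittedOn (tr : List (VTrans L S M)) (m : M) : Prop := ∃ t ∈ tr, t.out = some m

/-- The message `m` is received on the trace `tr`. -/
def ReceivedOn (tr : List (VTrans L S M)) (m : M) : Prop := ∃ t ∈ tr, t.msg = some m

/-- `sent` is a sent-oracle for `V`: at every constrained state `s`, `sent s m` holds
iff `m` is emitted on every constrained trace reaching `s`. -/
def IsSentOracle (V : VLSM L S M) (sent : S → M → Prop) : Prop :=
  ∀ s, V.ConstrainedState s → ∀ m,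
    (sent s m ↔ ∀ tr, V.ConstrainedTraceTo tr s → EmittedOn tr m)

/-- `recv` is a received-oracle for `V`. -/
def IsReceivedOracle (V : VLSM L S M) (recv : S → M → Prop) : Prop :=
  ∀ s, V.ConstrainedState s → ∀ m,
    (recv s m ↔ ∀ tr, V.ConstrainedTraceTo tr s → ReceivedOn tr m)

/-- The full node assumption: whenever receiving `m` is allowed by the validity
constraint, every direct dependency of `m` has been directly observed in the state. -/
def FullNodeAssumption (V : VLSM L S M) (dep : M → M → Prop)
    (sent recv : S → M → Prop) : Prop :=
  ∀ l s m, V.beta l s (some m) → ∀ m', dep m' m → sent s m' ∨ recv s m'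

section Composition

variable {ι : Type*} [DecidableEq ι] {Lf : ι → Type*} {Sf : ι → Type*}

/-- The constrained composition of an indexed family of VLSMs over the same
message set, under the composition constraint `φ`. -/
noncomputable def comp (V : ∀ i, VLSM (Lf i) (Sf i) M)
    (φ : (Σ i, Lf i) → (∀ i, Sf i) → Option M → Prop) :
    VLSM (Σ i, Lf i) (∀ i, Sf i) M where
  init := {σ | ∀ i, σ i ∈ (V i).init}
  init_ne := ⟨fun i => ((V i).init_ne).choose, fun i => ((V i).init_ne).choose_spec⟩
  initMsg := ⋃ i, (V i).initMsg
  tau := fun l σ m =>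
    (Function.update σ l.1 ((V l.1).tau l.2 (σ l.1) m).1, ((V l.1).tau l.2 (σ l.1) m).2)
  beta := fun l σ m => (V l.1).beta l.2 (σ l.1) m ∧ φ l σ m

/-- The free composition of an indexed family of VLSMs over the same message set. -/
noncomputable def freeComp (V : ∀ i, VLSM (Lf i) (Sf i) M) :
    VLSM (Σ i, Lf i) (∀ i, Sf i) M :=
  comp V fun _ _ _ => True

/-- Component `j` is a validator for the composite VLSM `W`: every constrained
transition from a constrained state of `V j` lifts to a valid transition of `W`
with matching `j`-th state components and matching input/output messages. -/
def IsValidatorAt (V : ∀ i, VLSM (Lf i) (Sf i) M)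
    (W : VLSM (Σ i, Lf i) (∀ i, Sf i) M) (j : ι) : Prop :=
  ∀ l s m, (V j).ConstrainedState s → (V j).beta l s m →
    ∃ σ : ∀ i, Sf i, σ j = s ∧
      W.IsValidTrans ⟨⟨j, l⟩, σ, m, (W.tau ⟨j, l⟩ σ m).1, (W.tau ⟨j, l⟩ σ m).2⟩ ∧
      (W.tau ⟨j, l⟩ σ m).1 j = ((V j).tau l s m).1 ∧
      (W.tau ⟨j, l⟩ σ m).2 = ((V j).tau l s m).2

/-- The induced `j`-th projection of a composite VLSM `W`: the same VLSM as the
component `Vj`, except that its initial messages are all valid messages of `W`. -/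
def projV {L' : Type*} {S' : Type*} {L2 : Type*} {S2 : Type*}
    (Vj : VLSM L' S' M) (W : VLSM L2 S2 M) : VLSM L' S' M :=
  { Vj with initMsg := {m | W.ValidOMsg (some m)} }

/-- The projection of a composite trace on component `j`. -/
def projTrace (j : ι) (tr : List (VTrans (Σ i, Lf i) (∀ i, Sf i) M)) :
    List (VTrans (Lf j) (Sf j) M) :=
  tr.filterMap fun t =>
    if h : t.lbl.1 = j then some ⟨h ▸ t.lbl.2, t.src j, t.msg, t.dst j, t.out⟩ else none

/-- The composition constraint of the fixed-set message-equivocation model: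
the only message-equivocations allowed are among the components of `E`. -/
def phiM (sender : M → ι) (sent : ∀ i, Sf i → M → Prop) (E : Set ι) :
    (Σ i, Lf i) → (∀ i, Sf i) → Option M → Prop :=
  fun l σ m => ∀ mm, m = some mm →
    (sent (sender mm) (σ (sender mm)) mm ∨ (l.1 ∈ E ∧ sender mm ∈ E))

end Composition

/-- Labels of the equivocating VLSM associated to a VLSM: act as the `i`-th copy,
duplicate the `i`-th copy, or spawn a new machine after position `i` (1-based). -/
inductive ELabel (L : Type u) (S : Type v) where
  | act (i : ℕ) (l : L)
  | dup (i : ℕ)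
  | new (i : ℕ) (s : S)

/-- The equivocating VLSM associated to a VLSM `V`: its states are (nonempty) lists
of states of `V`, and it can fork itself or spawn fresh copies at any moment. -/
noncomputable def eVLSM (V : VLSM L S M) : VLSM (ELabel L S) (List S) M where
  init := {γ | ∃ s ∈ V.init, γ = [s]}
  init_ne := ⟨[V.init_ne.choose], V.init_ne.choose, V.init_ne.choose_spec, rfl⟩
  initMsg := V.initMsg
  tau := fun lab γ m =>
    match lab with
    | .act i l =>
      match γ[i - 1]? with
      | some s => (γ.set (i - 1) (V.tau l s m).1, (V.tau l s m).2)
      | none => (γ, Option.none)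
    | .dup i =>
      match γ[i - 1]? with
      | some s => (γ.take i ++ s :: γ.drop i, Option.none)
      | none => (γ, Option.none)
    | .new i s0 => (γ.take i ++ s0 :: γ.drop i, Option.none)
  beta := fun lab γ m =>
    match lab with
    | .act i l => 1 ≤ i ∧ i ≤ γ.length ∧ ∃ s, γ[i - 1]? = some s ∧ V.beta l s m
    | .dup i => 1 ≤ i ∧ i ≤ γ.length ∧ m = Option.none
    | .new i s0 => 1 ≤ i ∧ i ≤ γ.length ∧ m = Option.none ∧ s0 ∈ V.init

/-- The two labels of UMO/MO/ELMO components. -/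
inductive UL where
  | send
  | recv
deriving DecidableEq

/-- States (= messages) of UMO components: a finite list of message observations
together with an address. -/
inductive UState where
  | mk (obs : List (UL × UState)) (addr : ℕ)

/-- The list of message observations of a state. -/
def UState.obs : UState → List (UL × UState)
  | .mk o _ => o

/-- The address of a state. -/
def UState.addr : UState → ℕ
  | .mk _ i => i

/-- The set of messages observed as sent in a state. -/
def UState.sentMessages (s : UState) : Set UState := {m | (UL.send, m) ∈ s.obs}

/-- The set of messages observed as received in a state. -/
def UState.receivedMessages (s : UState) : Set UState := {m | (UL.recv, m) ∈ s.obs}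

/-- The set of messages observed in a state. -/
def UState.messages (s : UState) : Set UState := {m | ∃ l, (l, m) ∈ s.obs}

/-- The validity constraint of UMO components. -/
def betaUMO (l : UL) (_ : UState) (m : Option UState) : Prop :=
  (l = UL.send ∧ m = Option.none) ∨ (l = UL.recv ∧ m ≠ Option.none)

/-- The transition function of UMO (and MO, ELMO) components. -/
def tauUMO (l : UL) (s : UState) (m : Option UState) : UState × Option UState :=
  match l, m with
  | .send, Option.none => (UState.mk (s.obs ++ [(UL.send, s)]) s.addr, some s)
  | .recv, some mm => (UState.mk (s.obs ++ [(UL.recv, mm)]) s.addr, Option.none)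
  | _, _ => (s, m)

/-- The UMO component of address `i`. -/
noncomputable def UMO (i : ℕ) : VLSM UL UState UState where
  init := {UState.mk [] i}
  init_ne := ⟨UState.mk [] i, rfl⟩
  initMsg := ∅
  tau := tauUMO
  beta := betaUMO

/-- The UMO protocol: the free composition of the UMO components of addresses 1,…,n. -/
noncomputable def UMOProtocol (n : ℕ) : VLSM (Σ _ : Fin n, UL) (Fin n → UState) UState :=
  freeComp fun k : Fin n => UMO (k.1 + 1)

theorem chain_concat_iff (tr : List (VTrans L S M)) (t : VTrans L S M) (s sf : S) :
    Chain s (tr ++ [t]) sf ↔ Chain s tr t.src ∧ t.dst = sf := by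
  induction tr generalizing s with
  | nil => simp only [List.nil_append, Chain, eq_comm]
  | cons a tr ih => simp only [List.cons_append, Chain, ih, and_assoc]

namespace VLSM

theorem constrainedTraceTo_nil_iff (V : VLSM L S M) (sf : S) :
    V.ConstrainedTraceTo [] sf ↔ sf ∈ V.init := by
  simp [ConstrainedTraceTo, Chain]

theorem constrainedTraceTo_concat_iff (V : VLSM L S M) (tr : List (VTrans L S M))
    (t : VTrans L S M) (sf : S) :
    V.ConstrainedTraceTo (tr ++ [t]) sf ↔
      V.ConstrainedTraceTo tr t.src ∧ V.IsConstrainedTrans t ∧ t.dst = sf := by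
  simp only [ConstrainedTraceTo, chain_concat_iff, List.forall_mem_append,
    List.forall_mem_singleton]
  tauto

theorem ReachState.constrainedState {V : VLSM L S M} {s : S} (hs : V.ReachState s) :
    V.ConstrainedState s := by
  induction hs with
  | init h => exact ⟨[], (V.constrainedTraceTo_nil_iff _).2 h⟩
  | @step l s m _ hβ ih =>
    obtain ⟨tr, htr⟩ := ih
    refine ⟨tr ++ [⟨l, s, m, (V.tau l s m).1, (V.tau l s m).2⟩], ?_⟩
    rw [constrainedTraceTo_concat_iff]
    exact ⟨htr, ⟨rfl, hβ⟩, rfl⟩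

end VLSM

/-- A constrained transition of a UMO component either sends the current state or receives
a message, and records this as the last observation. -/
theorem UMO_isConstrainedTrans_cases {i : ℕ} {t : VTrans UL UState UState}
    (ht : (UMO i).IsConstrainedTrans t) :
    (∃ s, t = ⟨.send, s, none, .mk (s.obs ++ [(.send, s)]) s.addr, some s⟩) ∨
      ∃ s m, t = ⟨.recv, s, some m, .mk (s.obs ++ [(.recv, m)]) s.addr, none⟩ := by
  obtain ⟨l, s, m, s', out⟩ := t
  obtain ⟨hτ, hβ⟩ := ht
  rcases l with _ | _ <;> rcases m with _ | m <;>
    simp_all [VLSM.IsTrans, UMO, tauUMO, betaUMO]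

theorem UMO_isConstrainedTrans_dst_obs_ne_nil {i : ℕ} {t : VTrans UL UState UState}
    (ht : (UMO i).IsConstrainedTrans t) : t.dst.obs ≠ [] := by
  rcases UMO_isConstrainedTrans_cases ht with ⟨s, rfl⟩ | ⟨s, m, rfl⟩ <;> simp [UState.obs]

/-- A constrained transition of a UMO component is determined by its target state. -/
theorem UMO_isConstrainedTrans_eq_of_dst_eq {i : ℕ} {t t' : VTrans UL UState UState}
    (ht : (UMO i).IsConstrainedTrans t) (ht' : (UMO i).IsConstrainedTrans t')
    (h : t.dst = t'.dst) : t = t' := by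
  have ext_obs : ∀ a b : UState, a.obs = b.obs → a.addr = b.addr → a = b := by
    rintro ⟨o, j⟩ ⟨o', j'⟩ rfl rfl
    rfl
  rcases UMO_isConstrainedTrans_cases ht with ⟨s, rfl⟩ | ⟨s, m, rfl⟩ <;>
    rcases UMO_isConstrainedTrans_cases ht' with ⟨s', rfl⟩ | ⟨s', m', rfl⟩ <;>
    obtain ⟨ho, ha⟩ := UState.mk.inj h <;>
    obtain ⟨ho, hm⟩ := List.append_inj' ho rfl <;>
    simp_all [ext_obs s s' ho ha]

theorem UMO_constrainedTraceTo_unique {i : ℕ} {s : UState}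
    {tr tr' : List (VTrans UL UState UState)}
    (h : (UMO i).ConstrainedTraceTo tr s) (h' : (UMO i).ConstrainedTraceTo tr' s) :
    tr = tr' := by
  have obs_init : ∀ a ∈ (UMO i).init, a.obs = [] := by
    rintro _ rfl
    rfl
  induction tr using List.reverseRecOn generalizing s tr' with
  | nil =>
    rcases List.eq_nil_or_concat' tr' with rfl | ⟨tr', t', rfl⟩
    · rfl
    · rw [VLSM.constrainedTraceTo_nil_iff] at h
      obtain ⟨-, ht', rfl⟩ := (VLSM.constrainedTraceTo_concat_iff _ _ _ _).1 h'
      exact absurd (obs_init _ h) (UMO_isConstrainedTrans_dst_obs_ne_nil ht')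
  | append_singleton tr t ih =>
    obtain ⟨htr, ht, rfl⟩ := (VLSM.constrainedTraceTo_concat_iff _ _ _ _).1 h
    rcases List.eq_nil_or_concat' tr' with rfl | ⟨tr', t', rfl⟩
    · rw [VLSM.constrainedTraceTo_nil_iff] at h'
      exact absurd (obs_init _ h') (UMO_isConstrainedTrans_dst_obs_ne_nil ht)
    · obtain ⟨htr', ht', hd⟩ := (VLSM.constrainedTraceTo_concat_iff _ _ _ _).1 h'
      obtain rfl := UMO_isConstrainedTrans_eq_of_dst_eq ht' ht hd
      rw [ih htr htr']

/-- From every constrained state of an UMO component we can extract a unique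
constrained trace reaching it. -/
theorem UMO_unique_trace (i : ℕ) (s : UState) (hs : (UMO i).ReachState s) :
    ∃! tr : List (VTrans UL UState UState), (UMO i).ConstrainedTraceTo tr s := by
  obtain ⟨tr, htr⟩ := hs.constrainedState
  exact ⟨tr, htr, fun _ h => UMO_constrainedTraceTo_unique h htr⟩
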